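/- Let T : k(Γ;F) → k(Δ;G) be a Σ-preserving k-linear map. Then there exists a unique linear map T^⊥ : k(Δ;G^⊥) → k(Γ;F^⊥) such that ⟨T f, g⟩ = ⟨f, T^⊥ g⟩ for all f ∈ k(Γ;F) and g ∈ k(Δ;G^⊥); moreover T^⊥ is Σ-preserving. -/

import Mathlib

open Function

structure Borno (Γ : Type) where
  sets : Set (Set Γ)
  finite_mem : ∀ s : Set Γ, s.Finite → s ∈ sets
  subset_mem : ∀ s t : Set Γ, s ⊆ t → t ∈ sets → s ∈ sets
  union_mem : ∀ s t : Set Γ, s ∈ sets → t ∈ sets → s ∪ t ∈ sets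

def Borno.orth {Γ : Type} (F : Borno Γ) : Borno Γ where
  sets := {S | ∀ A ∈ F.sets, (S ∩ A).Finite}
  finite_mem := fun _ hs A _ => hs.inter_of_left A
  subset_mem := fun s t hst ht A hA =>
    (ht A hA).subset (Set.inter_subset_inter hst (subset_refl A))
  union_mem := fun s t hs ht A hA => by
    rw [Set.union_inter_distrib_right]
    exact (hs A hA).union (ht A hA)

def bspace (k : Type) [Field k] {Γ : Type} (F : Borno Γ) : Submodule k (Γ → k) where
  carrier := {f | Function.support f ∈ F.sets}
  add_mem' := fun {f} {g} hf hg =>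
    F.subset_mem _ _ (Function.support_add f g) (F.union_mem _ _ hf hg)
  zero_mem' := F.finite_mem _ (by simp)
  smul_mem' := fun c f hf =>
    F.subset_mem _ _ (Function.support_const_smul_subset c f) hf

def SummableFam {k : Type} [Field k] {Γ : Type} (F : Borno Γ) {ι : Type} (f : ι → Γ → k) : Prop :=
  (⋃ i, Function.support (f i)) ∈ F.sets ∧ ∀ γ : Γ, {i | f i γ ≠ 0}.Finite

noncomputable def famSum {k Γ ι : Type} [Field k] (f : ι → Γ → k) : Γ → k :=
  fun γ => ∑ᶠ i, f i γ

theorem famSum_mem {k : Type} [Field k] {Γ ι : Type} (F : Borno Γ) (f : ι → Γ → k)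
    (hf : SummableFam F f) : famSum f ∈ bspace k F := by
  refine F.subset_mem _ _ ?_ hf.1
  intro γ hγ
  by_contra hns
  simp only [Set.mem_iUnion, Function.mem_support] at hns
  push_neg at hns
  exact hγ (by simpa [famSum] using finsum_eq_zero_of_forall_eq_zero hns)

noncomputable def sumElem {k : Type} [Field k] {Γ ι : Type} (F : Borno Γ)
    (f : ι → bspace k F) (hf : SummableFam F (fun i => (f i : Γ → k))) : bspace k F :=
  ⟨famSum (fun i => (f i : Γ → k)), famSum_mem F _ hf⟩

def SigmaPreserving {k : Type} [Field k] {Γ Δ : Type} {F : Borno Γ} {G : Borno Δ}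
    (T : bspace k F →ₗ[k] bspace k G) : Prop :=
  ∀ (ι : Type) (f : ι → bspace k F) (hf : SummableFam F (fun i => (f i : Γ → k))),
    ∃ hg : SummableFam G (fun i => (T (f i) : Δ → k)),
      T (sumElem F f hf) = sumElem G (fun i => T (f i)) hg

noncomputable def pairing {k Γ : Type} [Field k] (f g : Γ → k) : k := ∑ᶠ γ, f γ * g γ

noncomputable def indic {k : Type} [Field k] {Γ : Type} (F : Borno Γ) (γ : Γ) : bspace k F :=
  ⟨Set.indicator {γ} (fun _ => (1 : k)),
    F.subset_mem _ _ Set.support_indicator_subset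
      (F.finite_mem _ (Set.finite_singleton γ))⟩

theorem finite_support_uncurry_mul {k Γ ι : Type} [Field k] (f : ι → Γ → k) (h : Γ → k)
    (hU : ((⋃ i, support (f i)) ∩ support h).Finite) (hf : ∀ γ, {i | f i γ ≠ 0}.Finite) :
    (support fun p : Γ × ι => f p.2 p.1 * h p.1).Finite := by
  refine (hU.biUnion fun γ _ => (hf γ).image (Prod.mk γ)).subset ?_
  rintro ⟨γ, i⟩ hp
  have h₁ : f i γ ≠ 0 := left_ne_zero_of_mul hp
  have h₂ : h γ ≠ 0 := right_ne_zero_of_mul hp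
  exact Set.mem_biUnion ⟨Set.mem_iUnion.2 ⟨i, h₁⟩, h₂⟩ ⟨i, h₁, rfl⟩

theorem exists_mul_ne_zero_of_pairing_ne_zero {k Γ : Type} [Field k] {f g : Γ → k}
    (h : pairing f g ≠ 0) : ∃ γ, f γ * g γ ≠ 0 :=
  not_forall.1 fun h₀ => h (finsum_eq_zero_of_forall_eq_zero h₀)

theorem finite_setOf_pairing_ne_zero {k Γ ι : Type} [Field k] (f : ι → Γ → k) (h : Γ → k)
    (hU : ((⋃ i, support (f i)) ∩ support h).Finite) (hf : ∀ γ, {i | f i γ ≠ 0}.Finite) :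
    {i | pairing (f i) h ≠ 0}.Finite := by
  refine ((finite_support_uncurry_mul f h hU hf).image Prod.snd).subset fun i hi => ?_
  obtain ⟨γ, hγ⟩ := exists_mul_ne_zero_of_pairing_ne_zero hi
  exact ⟨(γ, i), hγ, rfl⟩

theorem pairing_famSum {k Γ ι : Type} [Field k] (f : ι → Γ → k) (h : Γ → k)
    (hU : ((⋃ i, support (f i)) ∩ support h).Finite) (hf : ∀ γ, {i | f i γ ≠ 0}.Finite) :
    pairing (famSum f) h = ∑ᶠ i, pairing (f i) h := by
  have hfin := finite_support_uncurry_mul f h hU hf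
  have hfin' : (support fun p : ι × Γ => f p.1 p.2 * h p.2).Finite :=
    (hfin.image Prod.swap).subset fun p hp => ⟨p.swap, hp, Prod.swap_swap p⟩
  calc pairing (famSum f) h = ∑ᶠ γ, ∑ᶠ i, f i γ * h γ :=
        finsum_congr fun γ => finsum_mul (fun i => f i γ) (h γ)
    _ = ∑ᶠ p : Γ × ι, f p.2 p.1 * h p.1 := (finsum_curry _ hfin).symm
    _ = ∑ᶠ p : ι × Γ, f p.1 p.2 * h p.2 :=
        finsum_comp_equiv (Equiv.prodComm Γ ι) (f := fun p : ι × Γ => f p.1 p.2 * h p.2)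
    _ = ∑ᶠ i, pairing (f i) h := finsum_curry _ hfin'

theorem pairing_comm {k Γ : Type} [Field k] (f g : Γ → k) : pairing f g = pairing g f :=
  finsum_congr fun _ => mul_comm _ _

theorem smul_pairing {k Γ : Type} [Field k] (c : k) (f g : Γ → k) :
    pairing (c • f) g = c * pairing f g := by
  simp only [pairing, Pi.smul_apply, smul_eq_mul, mul_assoc]
  exact (smul_finsum c fun γ => f γ * g γ).symm

theorem pairing_add {k Γ : Type} [Field k] {f g h : Γ → k}
    (hg : (support f ∩ support g).Finite) (hh : (support f ∩ support h).Finite) :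
    pairing f (g + h) = pairing f g + pairing f h := by
  simp only [pairing, Pi.add_apply, mul_add]
  exact finsum_add_distrib (by rwa [← support_mul] at hg) (by rwa [← support_mul] at hh)

theorem coe_indic_apply {k Γ : Type} [Field k] (F : Borno Γ) (γ x : Γ) [Decidable (x = γ)] :
    (indic (k := k) F γ : Γ → k) x = if x = γ then 1 else 0 := by
  simp [indic, Set.indicator_apply]

theorem pairing_indic {k Γ : Type} [Field k] (F : Borno Γ) (γ : Γ) (h : Γ → k) :
    pairing (indic (k := k) F γ : Γ → k) h = h γ := by
  classical
  rw [pairing, finsum_eq_single _ γ fun x hx => by simp [coe_indic_apply, hx]]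
  simp [coe_indic_apply]

theorem finite_support_inter {k : Type} [Field k] {Γ : Type} {F : Borno Γ}
    (f : bspace k F) (g : bspace k F.orth) :
    (support (f : Γ → k) ∩ support (g : Γ → k)).Finite :=
  Set.inter_comm _ _ ▸ g.2 _ f.2

theorem summableFam_smul_indic {k Γ : Type} [Field k] {F : Borno Γ} {f : Γ → k}
    (hf : support f ∈ F.sets) :
    SummableFam F fun γ => ((f γ • indic F γ : bspace k F) : Γ → k) := by
  classical
  refine ⟨F.subset_mem _ _ (Set.iUnion_subset fun γ x hx => ?_) hf,
    fun x => (Set.finite_singleton x).subset fun γ hγ => ?_⟩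
  · have hx' : x = γ ∧ f γ ≠ 0 := by simpa [coe_indic_apply] using hx
    rw [hx'.1]
    exact hx'.2
  · have hx' : x = γ ∧ f γ ≠ 0 := by simpa [coe_indic_apply] using hγ
    exact hx'.1.symm

theorem sumElem_smul_indic {k Γ : Type} [Field k] {F : Borno Γ} (f : bspace k F) :
    sumElem F (fun γ => (f : Γ → k) γ • indic F γ) (summableFam_smul_indic f.2) = f := by
  classical
  ext x
  change ∑ᶠ γ, ((f : Γ → k) γ • indic F γ : bspace k F).1 x = _
  rw [finsum_eq_single _ x fun γ hγ => by simp [coe_indic_apply, hγ.symm]]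
  simp [coe_indic_apply]

theorem pairing_map_eq_finsum {k Γ Δ : Type} [Field k] {F : Borno Γ} {G : Borno Δ}
    {T : bspace k F →ₗ[k] bspace k G} (hT : SigmaPreserving T)
    (f : bspace k F) (g : bspace k G.orth) :
    pairing (T f : Δ → k) (g : Δ → k) =
      pairing (f : Γ → k) fun γ => pairing (T (indic F γ) : Δ → k) (g : Δ → k) := by
  obtain ⟨hs, heq⟩ := hT Γ _ (summableFam_smul_indic f.2)
  rw [sumElem_smul_indic] at heq
  rw [heq]
  refine (pairing_famSum _ _ (Set.inter_comm _ _ ▸ g.2 _ hs.1) hs.2).trans ?_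
  refine finsum_congr fun γ => ?_
  rw [map_smul]
  exact smul_pairing _ _ _

/-- A `Σ`-preserving map has only finitely many columns indexed by a set of `F` that meet a given
set of `G^⊥`. -/
theorem SigmaPreserving.finite_columns {k Γ Δ : Type} [Field k] {F : Borno Γ} {G : Borno Δ}
    {T : bspace k F →ₗ[k] bspace k G} (hT : SigmaPreserving T)
    {A : Set Γ} (hA : A ∈ F.sets) {C : Set Δ} (hC : C ∈ G.orth.sets) :
    {γ ∈ A | ∃ δ ∈ C, (T (indic F γ) : Δ → k) δ ≠ 0}.Finite := by
  classical
  let a : Γ → k := A.indicator 1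
  have ha : support a ∈ F.sets := F.subset_mem _ _ Set.support_indicator_subset hA
  obtain ⟨hs, -⟩ := hT Γ _ (summableFam_smul_indic ha)
  refine ((hC _ hs.1).biUnion fun δ _ => hs.2 δ).subset ?_
  rintro γ ⟨hγ, δ, hδ, hne⟩
  have hne' : (T (a γ • indic F γ) : Δ → k) δ ≠ 0 := by simpa [a, hγ] using hne
  exact Set.mem_biUnion ⟨hδ, Set.mem_iUnion.2 ⟨γ, hne'⟩⟩ hne'

theorem SigmaPreserving.setOf_column_mem_orth {k Γ Δ : Type} [Field k] {F : Borno Γ} {G : Borno Δ}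
    {T : bspace k F →ₗ[k] bspace k G} (hT : SigmaPreserving T)
    {C : Set Δ} (hC : C ∈ G.orth.sets) :
    {γ | ∃ δ ∈ C, (T (indic F γ) : Δ → k) δ ≠ 0} ∈ F.orth.sets :=
  fun _ hA => (hT.finite_columns hA hC).subset fun _ h => ⟨h.2, h.1⟩

theorem support_pairing_column_subset {k Γ Δ : Type} [Field k] {F : Borno Γ} {G : Borno Δ}
    (T : bspace k F →ₗ[k] bspace k G) {g : Δ → k} {C : Set Δ} (hg : support g ⊆ C) :
    (support fun γ => pairing (T (indic F γ) : Δ → k) g) ⊆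
      {γ | ∃ δ ∈ C, (T (indic F γ) : Δ → k) δ ≠ 0} := by
  intro γ hγ
  obtain ⟨δ, hδ⟩ := exists_mul_ne_zero_of_pairing_ne_zero hγ
  exact ⟨δ, hg (right_ne_zero_of_mul hδ), left_ne_zero_of_mul hδ⟩

/-- The adjoint of a `Σ`-preserving map, obtained by pairing with its columns. -/
noncomputable def SigmaPreserving.adjoint {k Γ Δ : Type} [Field k] {F : Borno Γ} {G : Borno Δ}
    {T : bspace k F →ₗ[k] bspace k G} (hT : SigmaPreserving T) :
    bspace k G.orth →ₗ[k] bspace k F.orth where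
  toFun g := ⟨fun γ => pairing (T (indic F γ) : Δ → k) (g : Δ → k),
    F.orth.subset_mem _ _ (support_pairing_column_subset T subset_rfl)
      (hT.setOf_column_mem_orth g.2)⟩
  map_add' g h := Subtype.ext <| funext fun _ =>
    pairing_add (finite_support_inter _ g) (finite_support_inter _ h)
  map_smul' c g := Subtype.ext <| funext fun γ => by
    change pairing _ (c • (g : Δ → k)) = c * pairing _ _
    rw [pairing_comm, smul_pairing, pairing_comm]

theorem SigmaPreserving.sigmaPreserving_adjoint {k Γ Δ : Type} [Field k] {F : Borno Γ}
    {G : Borno Δ} {T : bspace k F →ₗ[k] bspace k G} (hT : SigmaPreserving T) :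
    SigmaPreserving hT.adjoint := by
  intro ι g hg
  have hU (γ : Γ) : ((⋃ i, support (g i : Δ → k)) ∩
      support (T (indic F γ) : Δ → k)).Finite := hg.1 _ (T (indic F γ)).2
  refine ⟨⟨F.orth.subset_mem _ _ (Set.iUnion_subset fun i =>
      support_pairing_column_subset T (Set.subset_iUnion (fun i => support (g i : Δ → k)) i))
      (hT.setOf_column_mem_orth hg.1), fun γ => ?_⟩, Subtype.ext <| funext fun γ => ?_⟩
  · refine (finite_setOf_pairing_ne_zero _ _ (hU γ) hg.2).subset fun i hi => ?_
    rw [Set.mem_ofPred_eq, pairing_comm]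
    exact hi
  · change pairing _ (famSum _) = ∑ᶠ i, pairing _ _
    rw [pairing_comm, pairing_famSum _ _ (hU γ) hg.2]
    exact finsum_congr fun i => pairing_comm _ _

/-- a Σ-preserving linear map `T : k(Γ;F) → k(Δ;G)` has a unique adjoint
`T^⊥ : k(Δ;G^⊥) → k(Γ;F^⊥)` with `⟨T f, g⟩ = ⟨f, T^⊥ g⟩`, and `T^⊥` is Σ-preserving. -/
theorem stmt6 {k : Type} [Field k] {Γ Δ : Type} (F : Borno Γ) (G : Borno Δ)
    (T : bspace k F →ₗ[k] bspace k G) (hT : SigmaPreserving T) :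
    ∃ S : bspace k G.orth →ₗ[k] bspace k F.orth,
      (∀ (f : bspace k F) (g : bspace k G.orth),
        pairing ((T f : Δ → k)) ((g : Δ → k)) = pairing ((f : Γ → k)) ((S g : Γ → k))) ∧
      SigmaPreserving S ∧
      (∀ S' : bspace k G.orth →ₗ[k] bspace k F.orth,
        (∀ (f : bspace k F) (g : bspace k G.orth),
          pairing ((T f : Δ → k)) ((g : Δ → k)) = pairing ((f : Γ → k)) ((S' g : Γ → k))) →
        S' = S) := by
  refine ⟨hT.adjoint, pairing_map_eq_finsum hT, hT.sigmaPreserving_adjoint, fun S' hS' => ?_⟩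
  ext g γ
  rw [← pairing_indic F γ (S' g : Γ → k), ← hS']
  rfl
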